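/- Fix (p,q) ∈ ℤ². (a) If ker d'd'' ∩ A^{p,q} = (ker d' + Im d'') ∩ A^{p,q}, then ker d'' ∩ (Im d' + Im d'') ∩ A^{p+1,q} = Im d'' ∩ A^{p+1,q} (i.e., the natural map H_{d''}^{p+1,q} → H_A^{p+1,q} is injective). (b) If ker d'd'' ∩ A^{p,q} = (Im d' + ker d'') ∩ A^{p,q}, then ker d' ∩ (Im d' + Im d'') ∩ A^{p,q+1} = Im d' ∩ A^{p,q+1} (i.e., the natural map H_{d'}^{p,q+1} → H_A^{p,q+1} is injective). -/

import Mathlib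

open Submodule

/-- A double complex of complex vector spaces, realized as an internally bigraded
module `W = ⊕_{p,q} A p q` together with global differentials `d'`, `d''` of
bidegrees `(1,0)` and `(0,1)` satisfying `d'∘d' = 0`, `d''∘d'' = 0` and
`d'∘d'' + d''∘d' = 0`. -/
structure BiComplex (W : Type*) [AddCommGroup W] [Module ℂ W] where
  A : ℤ → ℤ → Submodule ℂ W
  d' : W →ₗ[ℂ] W
  d'' : W →ₗ[ℂ] W
  internal : DirectSum.IsInternal (fun pq : ℤ × ℤ => A pq.1 pq.2)
  map_d' : ∀ p q : ℤ, (A p q).map d' ≤ A (p + 1) q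
  map_d'' : ∀ p q : ℤ, (A p q).map d'' ≤ A p (q + 1)
  d'_sq : d' ∘ₗ d' = 0
  d''_sq : d'' ∘ₗ d'' = 0
  anticomm : d' ∘ₗ d'' + d'' ∘ₗ d' = 0

namespace BiComplex

variable {W : Type*} [AddCommGroup W] [Module ℂ W] (C : BiComplex W)

/-- `ker d' ∩ A^{p,q}` : the kernel of `d' : A^{p,q} → A^{p+1,q}`. -/
def kerd' (p q : ℤ) : Submodule ℂ W := LinearMap.ker C.d' ⊓ C.A p q

/-- `ker d'' ∩ A^{p,q}` : the kernel of `d'' : A^{p,q} → A^{p,q+1}`. -/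
def kerd'' (p q : ℤ) : Submodule ℂ W := LinearMap.ker C.d'' ⊓ C.A p q

/-- `Im d' ∩ A^{p,q} = d'(A^{p-1,q})`. -/
def imd' (p q : ℤ) : Submodule ℂ W := (C.A (p - 1) q).map C.d'

/-- `Im d'' ∩ A^{p,q} = d''(A^{p,q-1})`. -/
def imd'' (p q : ℤ) : Submodule ℂ W := (C.A p (q - 1)).map C.d''

/-- `Im d'd'' ∩ A^{p,q} = (d'∘d'')(A^{p-1,q-1})`. -/
def imd'd'' (p q : ℤ) : Submodule ℂ W := (C.A (p - 1) (q - 1)).map (C.d' ∘ₗ C.d'')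

/-- `ker d'd'' ∩ A^{p,q}` : the kernel of `d'∘d'' : A^{p,q} → A^{p+1,q+1}`. -/
def kerd'd'' (p q : ℤ) : Submodule ℂ W := LinearMap.ker (C.d' ∘ₗ C.d'') ⊓ C.A p q

/-- The `d'd''`-lemma at `(p,q)`:
`Im d' ∩ ker d'' ∩ A^{p,q} = ker d' ∩ Im d'' ∩ A^{p,q} = Im d'd'' ∩ A^{p,q}`. -/
def DDLemmaAt (p q : ℤ) : Prop :=
  C.imd' p q ⊓ C.kerd'' p q = C.imd'd'' p q ∧ C.kerd' p q ⊓ C.imd'' p q = C.imd'd'' p q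

/-- The total-degree piece `A^k = ⊕_{p+q=k} A^{p,q}`. -/
def Atot (k : ℤ) : Submodule ℂ W := ⨆ p : ℤ, C.A p (k - p)

/-- The total differential `d = d' + d''`. -/
def dtot : W →ₗ[ℂ] W := C.d' + C.d''

/-- `ker d ∩ A^k` : the kernel of `d : A^k → A^{k+1}`. -/
def kerdTot (k : ℤ) : Submodule ℂ W := LinearMap.ker C.dtot ⊓ C.Atot k

/-- `Im d ∩ A^k = d(A^{k-1})`. -/
def imdTot (k : ℤ) : Submodule ℂ W := (C.Atot (k - 1)).map C.dtot

/-- `ker d' ∩ ker d'' ∩ A^k = ⊕_{p+q=k} (ker d' ∩ ker d'' ∩ A^{p,q})`. -/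
def kerd'kerd''Tot (k : ℤ) : Submodule ℂ W :=
  ⨆ p : ℤ, (C.kerd' p (k - p) ⊓ C.kerd'' p (k - p))

/-- `Im d'd'' ∩ A^k = ⊕_{p+q=k} (Im d'd'' ∩ A^{p,q})`. -/
def imd'd''Tot (k : ℤ) : Submodule ℂ W := ⨆ p : ℤ, C.imd'd'' p (k - p)

/-- `ker d'd'' ∩ A^k = ⊕_{p+q=k} (ker d'd'' ∩ A^{p,q})`. -/
def kerd'd''Tot (k : ℤ) : Submodule ℂ W := ⨆ p : ℤ, C.kerd'd'' p (k - p)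

/-- `Im d' ∩ A^k = ⊕_{p+q=k} (Im d' ∩ A^{p,q})`. -/
def imd'Tot (k : ℤ) : Submodule ℂ W := ⨆ p : ℤ, C.imd' p (k - p)

/-- `Im d'' ∩ A^k = ⊕_{p+q=k} (Im d'' ∩ A^{p,q})`. -/
def imd''Tot (k : ℤ) : Submodule ℂ W := ⨆ p : ℤ, C.imd'' p (k - p)

/-- The double complex is totally bounded: `A^{p,q} = 0` for `|p| > N` or `|q| > N`. -/
def TotallyBounded : Prop :=
  ∃ N : ℕ, ∀ p q : ℤ, ((N : ℤ) < |p| ∨ (N : ℤ) < |q|) → C.A p q = ⊥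

end BiComplex

/-- The quotient vector space `S / T` of a submodule `S` by (the trace of) a
submodule `T ≤ S`. -/
abbrev quotSub {W : Type*} [AddCommGroup W] [Module ℂ W] (S T : Submodule ℂ W) :=
  S ⧸ (Submodule.comap S.subtype T)

namespace BiComplex

variable {W : Type*} [AddCommGroup W] [Module ℂ W] (C : BiComplex W)

lemma d'_d'_apply (x : W) : C.d' (C.d' x) = 0 := LinearMap.congr_fun C.d'_sq x

lemma d''_d''_apply (x : W) : C.d'' (C.d'' x) = 0 := LinearMap.congr_fun C.d''_sq x

lemma d'_d''_apply (x : W) : C.d' (C.d'' x) = -C.d'' (C.d' x) :=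
  eq_neg_of_add_eq_zero_left (LinearMap.congr_fun C.anticomm x)

lemma d'_mem {p q : ℤ} {x : W} (hx : x ∈ C.A p q) : C.d' x ∈ C.A (p + 1) q :=
  C.map_d' p q (Submodule.mem_map_of_mem hx)

lemma d''_mem {p q : ℤ} {x : W} (hx : x ∈ C.A p q) : C.d'' x ∈ C.A p (q + 1) :=
  C.map_d'' p q (Submodule.mem_map_of_mem hx)

lemma imd'_le_kerd' (p q : ℤ) : C.imd' p q ≤ C.kerd' p q := by
  rintro _ ⟨x, hx, rfl⟩
  exact ⟨C.d'_d'_apply x, by simpa using C.d'_mem hx⟩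

lemma imd''_le_kerd'' (p q : ℤ) : C.imd'' p q ≤ C.kerd'' p q := by
  rintro _ ⟨x, hx, rfl⟩
  exact ⟨C.d''_d''_apply x, by simpa using C.d''_mem hx⟩

/-- If `ker d'd'' = ker d' + Im d''` in bidegree `(p,q)`, then every `d''`-closed element of
`Im d'` in bidegree `(p+1,q)` is `d''`-exact. -/
lemma kerd''_inf_imd'_le_imd'' {p q : ℤ} (h : C.kerd'd'' p q ≤ C.kerd' p q ⊔ C.imd'' p q) :
    C.kerd'' (p + 1) q ⊓ C.imd' (p + 1) q ≤ C.imd'' (p + 1) q := by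
  rintro _ ⟨⟨hx, -⟩, a, ha, rfl⟩
  rw [add_sub_cancel_right] at ha
  have hx : C.d'' (C.d' a) = 0 := hx
  have hda : a ∈ C.kerd'd'' p q :=
    ⟨show C.d' (C.d'' a) = 0 by rw [d'_d''_apply, hx, neg_zero], ha⟩
  obtain ⟨k, ⟨hk, -⟩, _, ⟨c, hc, rfl⟩, rfl⟩ := Submodule.mem_sup.1 (h hda)
  have hk : C.d' k = 0 := hk
  exact ⟨-C.d' c, neg_mem (C.d'_mem hc), by rw [map_neg, map_add, hk, zero_add, d'_d''_apply]⟩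

/-- If `ker d'd'' = Im d' + ker d''` in bidegree `(p,q)`, then every `d'`-closed element of
`Im d''` in bidegree `(p,q+1)` is `d'`-exact. -/
lemma kerd'_inf_imd''_le_imd' {p q : ℤ} (h : C.kerd'd'' p q ≤ C.imd' p q ⊔ C.kerd'' p q) :
    C.kerd' p (q + 1) ⊓ C.imd'' p (q + 1) ≤ C.imd' p (q + 1) := by
  rintro _ ⟨⟨hx, -⟩, a, ha, rfl⟩
  rw [add_sub_cancel_right] at ha
  obtain ⟨_, ⟨c, hc, rfl⟩, k, ⟨hk, -⟩, rfl⟩ := Submodule.mem_sup.1 (h ⟨hx, ha⟩)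
  have hk : C.d'' k = 0 := hk
  exact ⟨-C.d'' c, neg_mem (C.d''_mem hc), by
    rw [map_neg, map_add, hk, add_zero, d'_d''_apply, neg_neg]⟩

end BiComplex

/-- Fix `(p,q)`.
(a) If `ker d'd'' ∩ A^{p,q} = (ker d' + Im d'') ∩ A^{p,q}`, then
`ker d'' ∩ (Im d' + Im d'') ∩ A^{p+1,q} = Im d'' ∩ A^{p+1,q}` (i.e. the map
`H_{d''}^{p+1,q} → H_A^{p+1,q}` is injective).
(b) If `ker d'd'' ∩ A^{p,q} = (Im d' + ker d'') ∩ A^{p,q}`, then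
`ker d' ∩ (Im d' + Im d'') ∩ A^{p,q+1} = Im d' ∩ A^{p,q+1}` (i.e. the map
`H_{d'}^{p,q+1} → H_A^{p,q+1}` is injective). -/
theorem bicomplex_psi_pm_surj_implies_inj
    {W : Type*} [AddCommGroup W] [Module ℂ W] (C : BiComplex W) (p q : ℤ) :
    (C.kerd'd'' p q = C.kerd' p q ⊔ C.imd'' p q →
      C.kerd'' (p + 1) q ⊓ (C.imd' (p + 1) q ⊔ C.imd'' (p + 1) q) =
        C.imd'' (p + 1) q) ∧
    (C.kerd'd'' p q = C.imd' p q ⊔ C.kerd'' p q →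
      C.kerd' p (q + 1) ⊓ (C.imd' p (q + 1) ⊔ C.imd'' p (q + 1)) =
        C.imd' p (q + 1)) := by
  refine ⟨fun h => ?_, fun h => ?_⟩
  · rw [← inf_sup_assoc_of_le _ (C.imd''_le_kerd'' (p + 1) q)]
    exact sup_eq_right.2 (C.kerd''_inf_imd'_le_imd'' h.le)
  · rw [sup_comm, ← inf_sup_assoc_of_le _ (C.imd'_le_kerd' p (q + 1))]
    exact sup_eq_right.2 (C.kerd'_inf_imd''_le_imd' h.le)
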